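/- arXiv:2003.10786 — 2 statements merged into one kernel-verified Lean document; each statement's English description precedes it below -/
import Mathlib

section
/- (Heat semigroup between Morrey spaces.) Let 1 ≤ q₁ ≤ q₂ < ∞ and 0 ≤ λ₁ ≤ λ₂ < 3, and set α₁ = (3−λ₁)/q₁ and α₂ = (3−λ₂)/q₂. Then there exists a constant C > 0, depending only on q₁, q₂, λ₁, λ₂, such that for every t > 0 and every f ∈ M^{q₁,λ₁}(ℝ³), t^{(α₁−α₂)/2} ‖G(·,t)∗f‖_{q₂,λ₂} ≤ C ‖f‖_{q₁,λ₁}. -/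
open MeasureTheory Metric Real Set Filter
open scoped ENNReal NNReal BigOperators Topology

noncomputable section

abbrev E3 : Type := EuclideanSpace ℝ (Fin 3)

/-- Morrey norm `‖f‖_{M^{p,λ}(ℝ³)}`. -/
def morreyNorm {F : Type*} [NormedAddCommGroup F] (p lam : ℝ) (f : E3 → F) : ℝ≥0∞ :=
  ⨆ (x : E3) (r : ℝ) (_ : 0 < r),
    ENNReal.ofReal (r ^ (-(lam / p))) *
      (∫⁻ y in Metric.ball x r, (‖f y‖₊ : ℝ≥0∞) ^ p) ^ (1 / p)

/-- Heat kernel on ℝ³. -/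
def heatKernel (t : ℝ) (x : E3) : ℝ :=
  (4 * π * t) ^ (-(3 : ℝ) / 2) * Real.exp (-‖x‖ ^ 2 / (4 * t))

theorem heatKernel_pos {t : ℝ} (ht : 0 < t) (x : E3) : 0 < heatKernel t x := by
  unfold heatKernel
  positivity

theorem continuous_heatKernel (t : ℝ) : Continuous (heatKernel t) := by
  unfold heatKernel
  fun_prop

theorem lintegral_heatKernel {t : ℝ} (ht : 0 < t) :
    ∫⁻ x, ENNReal.ofReal (heatKernel t x) = 1 := by
  have hb : 0 < 1 / (4 * t) := by positivity
  have h := GaussianFourier.integral_rexp_neg_mul_sq_norm (V := E3) hb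
  have hpos : (0 : ℝ) < 4 * π * t := by positivity
  have hI : ∫ x, heatKernel t x = 1 := by
    have hx : ∀ x : E3, heatKernel t x =
        (4 * π * t) ^ (-(3 : ℝ) / 2) * Real.exp (-(1 / (4 * t)) * ‖x‖ ^ 2) := by
      intro x
      unfold heatKernel
      congr 2
      ring
    simp_rw [hx]
    rw [integral_const_mul, h, finrank_euclideanSpace_fin,
      show π / (1 / (4 * t)) = 4 * π * t by field_simp, ← Real.rpow_add hpos]
    norm_num
  have hint : Integrable (heatKernel t) := by
    by_contra hn
    rw [integral_undef hn] at hI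
    norm_num at hI
  rw [← ofReal_integral_eq_lintegral_ofReal hint (ae_of_all _ fun x => (heatKernel_pos ht x).le),
    hI, ENNReal.ofReal_one]

/-- The sum `∑ₖ e^{-k²/4} (k+1)³` obtained by cutting `ℝ³` into the shells
`k√t ≤ |x - y| < (k+1)√t`, on which `e^{-|x - y|²/(4t)} ≤ e^{-k²/4}`. -/
def gaussianShellSum : ℝ≥0∞ :=
  ∑' k : ℕ, ENNReal.ofReal (Real.exp (-(k : ℝ) ^ 2 / 4) * ((k : ℝ) + 1) ^ (3 : ℕ))

theorem gaussianShellSum_ne_top : gaussianShellSum ≠ ∞ := by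
  refine Summable.tsum_ofReal_ne_top ?_
  have h := ((summable_nat_add_iff 1).2
    (Real.summable_pow_mul_exp_neg_nat_mul 3 (r := 1 / 4) (by norm_num))).mul_left (Real.exp (1 / 4))
  refine Summable.of_nonneg_of_le (fun k => by positivity) (fun k => ?_) h
  have hk : (k : ℝ) ≤ (k : ℝ) ^ 2 := by
    exact_mod_cast Nat.le_self_pow two_ne_zero k
  have he : Real.exp (-(k : ℝ) ^ 2 / 4) ≤
      Real.exp (1 / 4) * Real.exp (-(1 / 4) * ((k + 1 : ℕ) : ℝ)) := by
    rw [← Real.exp_add]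
    apply Real.exp_le_exp.2
    push_cast
    linarith
  calc _ ≤ (Real.exp (1 / 4) * Real.exp (-(1 / 4) * ((k + 1 : ℕ) : ℝ))) *
        ((k : ℝ) + 1) ^ (3 : ℕ) := by gcongr
    _ = _ := by push_cast; ring

theorem heatKernel_le_tsum_indicator {t : ℝ} (ht : 0 < t) (x y : E3) :
    ENNReal.ofReal (heatKernel t (x - y)) ≤
      ∑' k : ℕ, ENNReal.ofReal (t ^ (-(3 : ℝ) / 2) * Real.exp (-(k : ℝ) ^ 2 / 4)) *
        (ball x (((k : ℝ) + 1) * √t)).indicator 1 y := by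
  have hs : 0 < √t := Real.sqrt_pos.2 ht
  set k := ⌊‖x - y‖ / √t⌋₊ with hk
  refine le_trans ?_ (ENNReal.le_tsum k)
  have hy : y ∈ ball x (((k : ℝ) + 1) * √t) := by
    rw [mem_ball, dist_comm, dist_eq_norm, ← div_lt_iff₀ hs]
    exact Nat.lt_floor_add_one _
  rw [indicator_of_mem hy, Pi.one_apply, mul_one]
  apply ENNReal.ofReal_le_ofReal
  unfold heatKernel
  have h1 : (4 * π * t) ^ (-(3 : ℝ) / 2) ≤ t ^ (-(3 : ℝ) / 2) := by
    apply Real.rpow_le_rpow_of_nonpos ht _ (by norm_num)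
    nlinarith [Real.pi_gt_three]
  have h2 : (k : ℝ) * √t ≤ ‖x - y‖ := by
    rw [← le_div_iff₀ hs]
    exact Nat.floor_le (by positivity)
  have h3 : (k : ℝ) ^ 2 * t ≤ ‖x - y‖ ^ 2 := by
    calc (k : ℝ) ^ 2 * t = ((k : ℝ) * √t) ^ 2 := by rw [mul_pow, Real.sq_sqrt ht.le]
      _ ≤ _ := by gcongr
  have h4 : -‖x - y‖ ^ 2 / (4 * t) ≤ -(k : ℝ) ^ 2 / 4 := by
    rw [div_le_div_iff₀ (by positivity) (by norm_num)]
    linarith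
  gcongr

theorem lintegral_heatKernel_mul_le {t : ℝ} (ht : 0 < t) {lam : ℝ} (hlam : lam ≤ 3)
    {g : E3 → ℝ≥0∞} (hg : Measurable g) {M : ℝ≥0∞}
    (hM : ∀ x r, 0 < r → ∫⁻ y in ball x r, g y ≤ ENNReal.ofReal (r ^ lam) * M) (x : E3) :
    ∫⁻ y, ENNReal.ofReal (heatKernel t (x - y)) * g y ≤
      gaussianShellSum * ENNReal.ofReal (t ^ (-(3 - lam) / 2)) * M := by
  have hs : 0 < √t := Real.sqrt_pos.2 ht
  have hind : ∀ (k : ℕ) (y : E3), (ball x (((k : ℝ) + 1) * √t)).indicator 1 y * g y =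
      (ball x (((k : ℝ) + 1) * √t)).indicator g y := by
    intro k y
    by_cases hy : y ∈ ball x (((k : ℝ) + 1) * √t) <;> simp [hy]
  calc ∫⁻ y, ENNReal.ofReal (heatKernel t (x - y)) * g y
      ≤ ∫⁻ y, ∑' k : ℕ, ENNReal.ofReal (t ^ (-(3 : ℝ) / 2) * Real.exp (-(k : ℝ) ^ 2 / 4)) *
        (ball x (((k : ℝ) + 1) * √t)).indicator g y := by
        refine lintegral_mono fun y => ?_
        simp_rw [← hind, ← mul_assoc]
        rw [ENNReal.tsum_mul_right]
        exact mul_le_mul_left (heatKernel_le_tsum_indicator ht x y) _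
    _ = ∑' k : ℕ, ENNReal.ofReal (t ^ (-(3 : ℝ) / 2) * Real.exp (-(k : ℝ) ^ 2 / 4)) *
        ∫⁻ y in ball x (((k : ℝ) + 1) * √t), g y := by
        rw [lintegral_tsum fun k =>
          ((hg.indicator measurableSet_ball).const_mul _).aemeasurable]
        refine tsum_congr fun k => ?_
        rw [lintegral_const_mul _ (hg.indicator measurableSet_ball),
          lintegral_indicator measurableSet_ball]
    _ ≤ ∑' k : ℕ, ENNReal.ofReal (Real.exp (-(k : ℝ) ^ 2 / 4) * ((k : ℝ) + 1) ^ (3 : ℕ)) *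
        (ENNReal.ofReal (t ^ (-(3 - lam) / 2)) * M) := by
        refine ENNReal.tsum_le_tsum fun k => ?_
        refine (mul_le_mul_right (hM x _ (by positivity)) _).trans ?_
        rw [← mul_assoc, ← mul_assoc, ← ENNReal.ofReal_mul (by positivity),
          ← ENNReal.ofReal_mul (by positivity)]
        refine mul_le_mul_left (ENNReal.ofReal_le_ofReal ?_) _
        have hk : ((k : ℝ) + 1) ^ lam ≤ ((k : ℝ) + 1) ^ (3 : ℕ) := by
          rw [← Real.rpow_natCast]
          exact Real.rpow_le_rpow_of_exponent_le (by linarith [k.cast_nonneg (α := ℝ)])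
            (by exact_mod_cast hlam)
        have ht' : t ^ (-(3 - lam) / 2) = t ^ (-(3 : ℝ) / 2) * t ^ (lam / 2) := by
          rw [← Real.rpow_add ht]
          congr 1
          ring
        have hst : √t ^ lam = t ^ (lam / 2) := by
          rw [Real.sqrt_eq_rpow, ← Real.rpow_mul ht.le]
          congr 1
          ring
        rw [Real.mul_rpow (by positivity) hs.le, hst, ht']
        calc _ = Real.exp (-(k : ℝ) ^ 2 / 4) * ((k : ℝ) + 1) ^ lam *
              (t ^ (-(3 : ℝ) / 2) * t ^ (lam / 2)) := by ring
          _ ≤ _ := by gcongr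
    _ = _ := by
        rw [ENNReal.tsum_mul_right, gaussianShellSum, mul_assoc]

theorem setLIntegral_heatKernel_mul_le {t : ℝ} (ht : 0 < t)
    {g : E3 → ℝ≥0∞} (hg : Measurable g) {r : ℝ} {A : ℝ≥0∞}
    (hA : ∀ x, ∫⁻ y in ball x r, g y ≤ A) (x₀ : E3) :
    ∫⁻ x in ball x₀ r, ∫⁻ y, ENNReal.ofReal (heatKernel t (x - y)) * g y ≤ A := by
  have hH : Measurable fun z => ENNReal.ofReal (heatKernel t z) :=
    (continuous_heatKernel t).measurable.ennreal_ofReal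
  have hsub : ∀ x : E3, ∫⁻ y, ENNReal.ofReal (heatKernel t (x - y)) * g y =
      ∫⁻ z, ENNReal.ofReal (heatKernel t z) * g (x - z) := by
    intro x
    rw [← lintegral_sub_left_eq_self _ x]
    simp
  simp_rw [hsub]
  rw [lintegral_lintegral_swap (by
    refine Measurable.aemeasurable ?_
    exact (hH.comp measurable_snd).mul (hg.comp (measurable_fst.sub measurable_snd)))]
  calc _ ≤ ∫⁻ z, ENNReal.ofReal (heatKernel t z) * A := by
        refine lintegral_mono fun z => ?_
        rw [lintegral_const_mul (f := fun x => g (x - z)) _ (hg.comp (measurable_id.sub_const z))]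
        refine mul_le_mul_right (le_trans (le_of_eq ?_) (hA (x₀ - z))) _
        rw [← lintegral_indicator measurableSet_ball, ← lintegral_indicator measurableSet_ball,
          ← lintegral_sub_right_eq_self ((ball (x₀ - z) r).indicator g) z]
        refine lintegral_congr fun x => ?_
        simp only [indicator, mem_ball, dist_sub_right]
    _ = A := by rw [lintegral_mul_const _ hH, lintegral_heatKernel ht, one_mul]

theorem enorm_heat_conv_rpow_le {t : ℝ} (ht : 0 < t) {q : ℝ} (hq : 1 ≤ q)
    {f : E3 → ℝ} (hf : Measurable f) (x : E3) :
    ‖∫ y, heatKernel t (x - y) * f y‖ₑ ^ q ≤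
      ∫⁻ y, ENNReal.ofReal (heatKernel t (x - y)) * ‖f y‖ₑ ^ q := by
  have hH : Measurable fun y => ENNReal.ofReal (heatKernel t (x - y)) :=
    ((continuous_heatKernel t).measurable.comp (measurable_const.sub measurable_id)).ennreal_ofReal
  set μ := (volume : Measure E3).withDensity fun y => ENNReal.ofReal (heatKernel t (x - y))
  have : IsProbabilityMeasure μ := ⟨by
    rw [withDensity_apply _ MeasurableSet.univ, Measure.restrict_univ,
      lintegral_sub_left_eq_self (fun y => ENNReal.ofReal (heatKernel t y)) x,
      lintegral_heatKernel ht]⟩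
  have h := eLpNorm'_le_eLpNorm'_of_exponent_le one_pos hq μ hf.aestronglyMeasurable
  simp only [eLpNorm', ENNReal.rpow_one, div_one] at h
  rw [lintegral_withDensity_eq_lintegral_mul _ hH hf.enorm,
    lintegral_withDensity_eq_lintegral_mul _ hH (hf.enorm.pow_const q)] at h
  have hu : ‖∫ y, heatKernel t (x - y) * f y‖ₑ ≤
      ∫⁻ y, ENNReal.ofReal (heatKernel t (x - y)) * ‖f y‖ₑ := by
    refine (enorm_integral_le_lintegral_enorm _).trans_eq (lintegral_congr fun y => ?_)
    rw [enorm_mul, Real.enorm_of_nonneg (heatKernel_pos ht _).le]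
  have hq0 : 0 < q := by linarith
  rw [← ENNReal.le_rpow_inv_iff hq0, ← one_div]
  exact hu.trans h

theorem setLIntegral_rpow_le_morreyNorm {F : Type*} [NormedAddCommGroup F] {p : ℝ} (hp : 0 < p)
    (lam : ℝ) (f : E3 → F) (x : E3) {r : ℝ} (hr : 0 < r) :
    ∫⁻ y in ball x r, ‖f y‖ₑ ^ p ≤ ENNReal.ofReal (r ^ lam) * morreyNorm p lam f ^ p := by
  have h : ENNReal.ofReal (r ^ (-(lam / p))) *
      (∫⁻ y in ball x r, ‖f y‖ₑ ^ p) ^ (1 / p) ≤ morreyNorm p lam f :=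
    le_iSup_of_le x (le_iSup_of_le r (le_iSup_of_le hr le_rfl))
  have h' := ENNReal.rpow_le_rpow h hp.le
  rw [ENNReal.mul_rpow_of_nonneg _ _ hp.le, ← ENNReal.rpow_mul, one_div_mul_cancel hp.ne',
    ENNReal.rpow_one, ENNReal.ofReal_rpow_of_nonneg (by positivity) hp.le,
    ← Real.rpow_mul hr.le, show -(lam / p) * p = -lam by field_simp] at h'
  calc _ = ENNReal.ofReal (r ^ lam) *
        (ENNReal.ofReal (r ^ (-lam)) * ∫⁻ y in ball x r, ‖f y‖ₑ ^ p) := by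
        rw [← mul_assoc, ← ENNReal.ofReal_mul (by positivity), ← Real.rpow_add hr]
        simp
    _ ≤ _ := by gcongr

theorem morreyNorm_le_of_setLIntegral_le {F : Type*} [NormedAddCommGroup F] {p : ℝ} (hp : 0 < p)
    {lam : ℝ} {f : E3 → F} {A : ℝ≥0∞}
    (h : ∀ x r, 0 < r → ∫⁻ y in ball x r, ‖f y‖ₑ ^ p ≤ ENNReal.ofReal (r ^ lam) * A ^ p) :
    morreyNorm p lam f ≤ A := by
  refine iSup_le fun x => iSup_le fun r => iSup_le fun hr => ?_
  calc _ ≤ ENNReal.ofReal (r ^ (-(lam / p))) * (ENNReal.ofReal (r ^ lam) * A ^ p) ^ (1 / p) := by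
        gcongr
        exact h x r hr
    _ = A := by
        rw [ENNReal.mul_rpow_of_nonneg _ _ (by positivity), ← ENNReal.rpow_mul,
          mul_one_div_cancel hp.ne', ENNReal.rpow_one,
          ENNReal.ofReal_rpow_of_nonneg (by positivity) (by positivity), ← Real.rpow_mul hr.le,
          ← mul_assoc, ← ENNReal.ofReal_mul (by positivity), ← Real.rpow_add hr]
        simp [div_eq_mul_inv]

theorem morreyNorm_congr_ae {F : Type*} [NormedAddCommGroup F] {p lam : ℝ} {f g : E3 → F}
    (h : f =ᵐ[volume] g) : morreyNorm p lam f = morreyNorm p lam g := by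
  unfold morreyNorm
  congr! 7 with x r hr
  refine lintegral_congr_ae (ae_restrict_of_ae ?_)
  filter_upwards [h] with y hy
  rw [hy]

/-- The two regimes `r ≤ √t` and `√t ≤ r` in the growth of `∫ |G(·,t) ∗ f| ^ q₂` over balls. -/
theorem setLIntegral_heat_conv_rpow_le {q₁ q₂ lam₁ lam₂ : ℝ}
    (hq₁ : 1 ≤ q₁) (hq : q₁ ≤ q₂) (hlam : lam₁ ≤ lam₂) (hlam₂ : lam₂ < 3)
    {t : ℝ} (ht : 0 < t) {f : E3 → ℝ} (hf : Measurable f) (x₀ : E3) {r : ℝ} (hr : 0 < r) :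
    ∫⁻ x in ball x₀ r, ‖∫ y, heatKernel t (x - y) * f y‖ₑ ^ q₂ ≤
      ENNReal.ofReal (r ^ lam₂) *
        (ENNReal.ofReal (t ^ (-(3 - lam₁) / 2 * (q₂ / q₁) + (3 - lam₂) / 2)) *
          (volume (ball (0 : E3) 1) * gaussianShellSum ^ (q₂ / q₁) +
            gaussianShellSum ^ (q₂ / q₁ - 1)) * morreyNorm q₁ lam₁ f ^ q₂) := by
  have hq₁0 : 0 < q₁ := by linarith
  set N := morreyNorm q₁ lam₁ f
  set K := gaussianShellSum
  set V := volume (ball (0 : E3) 1)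
  set s := q₂ / q₁ with hs
  have hs1 : 1 ≤ s := by rwa [hs, one_le_div hq₁0]
  have hqs : q₁ * s = q₂ := by rw [hs]; field_simp
  have hg : Measurable fun y => ‖f y‖ₑ ^ q₁ := hf.enorm.pow_const q₁
  have hM : ∀ x r, 0 < r →
      ∫⁻ y in ball x r, ‖f y‖ₑ ^ q₁ ≤ ENNReal.ofReal (r ^ lam₁) * N ^ q₁ :=
    fun x r hr => setLIntegral_rpow_le_morreyNorm hq₁0 lam₁ f x hr
  set v : E3 → ℝ≥0∞ := fun x => ∫⁻ y, ENNReal.ofReal (heatKernel t (x - y)) * ‖f y‖ₑ ^ q₁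
  set T := ENNReal.ofReal (t ^ (-(3 - lam₁) / 2)) with hT
  have hvA : ∀ x, v x ≤ K * T * N ^ q₁ :=
    lintegral_heatKernel_mul_le ht (hlam.trans hlam₂.le) hg hM
  have huv : ∀ x, ‖∫ y, heatKernel t (x - y) * f y‖ₑ ^ q₂ ≤ v x ^ s := by
    intro x
    rw [← hqs, ENNReal.rpow_mul]
    exact ENNReal.rpow_le_rpow (enorm_heat_conv_rpow_le ht hq₁ hf x) (by linarith)
  have hTpow : ∀ a : ℝ, 0 ≤ a → T ^ a = ENNReal.ofReal (t ^ (-(3 - lam₁) / 2 * a)) := by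
    intro a ha
    rw [hT, ENNReal.ofReal_rpow_of_nonneg (by positivity) ha, ← Real.rpow_mul ht.le]
  have hA : ∀ a : ℝ, 0 ≤ a → (K * T * N ^ q₁) ^ a =
      K ^ a * ENNReal.ofReal (t ^ (-(3 - lam₁) / 2 * a)) * N ^ (q₁ * a) := by
    intro a ha
    rw [ENNReal.mul_rpow_of_nonneg _ _ ha, ENNReal.mul_rpow_of_nonneg _ _ ha, hTpow a ha,
      ENNReal.rpow_mul]
  have hst : ∀ a : ℝ, √t ^ a = t ^ (a / 2) := by
    intro a
    rw [Real.sqrt_eq_rpow, ← Real.rpow_mul ht.le]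
    congr 1
    ring
  rcases le_total r √t with hrt | hrt
  · have hreal : t ^ (-(3 - lam₁) / 2 * s) * r ^ (3 : ℕ) ≤
        r ^ lam₂ * t ^ (-(3 - lam₁) / 2 * s + (3 - lam₂) / 2) := by
      have h := Real.rpow_le_rpow hr.le hrt (z := 3 - lam₂) (by linarith)
      rw [hst] at h
      have hr3 : r ^ (3 : ℕ) = r ^ lam₂ * r ^ (3 - lam₂) := by
        rw [← Real.rpow_add hr, ← Real.rpow_natCast]
        norm_num
      rw [Real.rpow_add ht, hr3]
      calc _ = r ^ lam₂ * t ^ (-(3 - lam₁) / 2 * s) * r ^ (3 - lam₂) := by ring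
        _ ≤ r ^ lam₂ * t ^ (-(3 - lam₁) / 2 * s) * t ^ ((3 - lam₂) / 2) := by gcongr
        _ = _ := by ring
    calc _ ≤ ∫⁻ _ in ball x₀ r, (K * T * N ^ q₁) ^ s :=
          lintegral_mono fun x => (huv x).trans (ENNReal.rpow_le_rpow (hvA x) (by linarith))
      _ = (V * K ^ s) *
          ENNReal.ofReal (t ^ (-(3 - lam₁) / 2 * s) * r ^ (3 : ℕ)) * N ^ q₂ := by
          rw [setLIntegral_const, hA s (by linarith), hqs, Measure.addHaar_ball_of_pos _ _ hr,
            finrank_euclideanSpace_fin, ENNReal.ofReal_mul (by positivity)]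
          ring
      _ ≤ (V * K ^ s + K ^ (s - 1)) * ENNReal.ofReal
          (r ^ lam₂ * t ^ (-(3 - lam₁) / 2 * s + (3 - lam₂) / 2)) * N ^ q₂ := by
          gcongr
          exact le_self_add
      _ = _ := by
          rw [ENNReal.ofReal_mul (by positivity)]
          ring
  · have hreal : t ^ (-(3 - lam₁) / 2 * (s - 1)) * r ^ lam₁ ≤
        r ^ lam₂ * t ^ (-(3 - lam₁) / 2 * s + (3 - lam₂) / 2) := by
      have h := Real.rpow_le_rpow_of_nonpos (Real.sqrt_pos.2 ht) hrt
        (z := lam₁ - lam₂) (by linarith)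
      rw [hst] at h
      have hr1 : r ^ lam₁ = r ^ lam₂ * r ^ (lam₁ - lam₂) := by
        rw [← Real.rpow_add hr]
        congr 1
        ring
      have ht1 : t ^ (-(3 - lam₁) / 2 * s + (3 - lam₂) / 2) =
          t ^ (-(3 - lam₁) / 2 * (s - 1)) * t ^ ((lam₁ - lam₂) / 2) := by
        rw [← Real.rpow_add ht]
        congr 1
        ring
      rw [hr1, ht1]
      calc _ = r ^ lam₂ * t ^ (-(3 - lam₁) / 2 * (s - 1)) * r ^ (lam₁ - lam₂) := by ring
        _ ≤ r ^ lam₂ * t ^ (-(3 - lam₁) / 2 * (s - 1)) * t ^ ((lam₁ - lam₂) / 2) := by gcongr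
        _ = _ := by ring
    have hvm : Measurable v := by
      refine Measurable.lintegral_prod_right' (f := fun z : E3 × E3 =>
        ENNReal.ofReal (heatKernel t (z.1 - z.2)) * ‖f z.2‖ₑ ^ q₁) ?_
      exact (((continuous_heatKernel t).measurable.comp
        (measurable_fst.sub measurable_snd)).ennreal_ofReal).mul (hg.comp measurable_snd)
    calc _ ≤ ∫⁻ x in ball x₀ r, (K * T * N ^ q₁) ^ (s - 1) * v x := by
          refine lintegral_mono fun x => (huv x).trans ?_
          calc v x ^ s = v x ^ (s - 1) * v x := by
                conv_rhs => rw [← ENNReal.rpow_one (v x), ← ENNReal.rpow_mul, one_mul,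
                  ← ENNReal.rpow_add_of_nonneg _ _ (by linarith) zero_le_one, sub_add_cancel]
            _ ≤ _ := by
                gcongr
                exact hvA x
      _ ≤ (K * T * N ^ q₁) ^ (s - 1) * (ENNReal.ofReal (r ^ lam₁) * N ^ q₁) := by
          rw [lintegral_const_mul _ hvm]
          gcongr
          exact setLIntegral_heatKernel_mul_le ht hg (fun x => hM x r hr) x₀
      _ = K ^ (s - 1) * ENNReal.ofReal (t ^ (-(3 - lam₁) / 2 * (s - 1)) * r ^ lam₁) *
          N ^ q₂ := by
          have hN : N ^ q₂ = N ^ (q₁ * (s - 1)) * N ^ q₁ := by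
            rw [← ENNReal.rpow_add_of_nonneg _ _
              (mul_nonneg hq₁0.le (by linarith)) hq₁0.le, ← hqs]
            congr 1
            ring
          rw [hA _ (by linarith), hN, ENNReal.ofReal_mul (by positivity)]
          ring
      _ ≤ (V * K ^ s + K ^ (s - 1)) * ENNReal.ofReal
          (r ^ lam₂ * t ^ (-(3 - lam₁) / 2 * s + (3 - lam₂) / 2)) * N ^ q₂ := by
          gcongr
          exact le_add_self
      _ = _ := by
          rw [ENNReal.ofReal_mul (by positivity)]
          ring

theorem integral_heatKernel_mul_eq_zero {t : ℝ} (ht : 0 < t) {f : E3 → ℝ}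
    (hf : ¬ AEStronglyMeasurable f volume) (x : E3) :
    ∫ y, heatKernel t (x - y) * f y = 0 := by
  refine integral_undef fun hint => hf ?_
  have hc : Continuous fun y => (heatKernel t (x - y))⁻¹ :=
    ((continuous_heatKernel t).comp (continuous_const.sub continuous_id)).inv₀
      fun y => (heatKernel_pos ht _).ne'
  refine (hc.aestronglyMeasurable.mul hint.aestronglyMeasurable).congr (ae_of_all _ fun y => ?_)
  exact inv_mul_cancel_left₀ (heatKernel_pos ht _).ne' _

/-- **Heat semigroup between Morrey spaces.**  For `1 ≤ q₁ ≤ q₂ < ∞`,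
`0 ≤ λ₁ ≤ λ₂ < 3`, `αᵢ = (3-λᵢ)/qᵢ`, one has
`t^{(α₁-α₂)/2} ‖G(·,t) ∗ f‖_{q₂,λ₂} ≤ C ‖f‖_{q₁,λ₁}` for all `t > 0`. -/
theorem heat_conv_morrey (q₁ q₂ lam₁ lam₂ : ℝ)
    (hq₁ : 1 ≤ q₁) (hq : q₁ ≤ q₂) (hlam₁ : 0 ≤ lam₁) (hlam : lam₁ ≤ lam₂)
    (hlam₂ : lam₂ < 3) :
    ∃ C : ℝ, 0 < C ∧ ∀ t : ℝ, 0 < t → ∀ f : E3 → ℝ,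
      ENNReal.ofReal (t ^ (((3 - lam₁) / q₁ - (3 - lam₂) / q₂) / 2)) *
          morreyNorm q₂ lam₂ (fun x => ∫ y, heatKernel t (x - y) * f y) ≤
        ENNReal.ofReal C * morreyNorm q₁ lam₁ f := by
  have hq₁0 : 0 < q₁ := by linarith
  have hq₂0 : 0 < q₂ := by linarith
  set D := volume (ball (0 : E3) 1) * gaussianShellSum ^ (q₂ / q₁) +
    gaussianShellSum ^ (q₂ / q₁ - 1)
  have hs1 : 1 ≤ q₂ / q₁ := by rwa [one_le_div hq₁0]
  have hD : D ^ (1 / q₂) ≠ ∞ := by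
    refine ENNReal.rpow_ne_top_of_nonneg (by positivity) (ENNReal.add_ne_top.2 ⟨?_, ?_⟩)
    · exact ENNReal.mul_ne_top measure_ball_lt_top.ne
        (ENNReal.rpow_ne_top_of_nonneg (by linarith) gaussianShellSum_ne_top)
    · exact ENNReal.rpow_ne_top_of_nonneg (by linarith) gaussianShellSum_ne_top
  refine ⟨(D ^ (1 / q₂)).toReal + 1, by positivity, fun t ht f => ?_⟩
  by_cases hf : AEStronglyMeasurable f volume
  swap
  · have h0 : morreyNorm q₂ lam₂ (fun _ : E3 => (0 : ℝ)) = 0 := by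
      simp [morreyNorm, ENNReal.zero_rpow_of_pos, hq₂0]
    simp_rw [integral_heatKernel_mul_eq_zero ht hf, h0, mul_zero, zero_le]
  obtain ⟨g, hg, hfg⟩ := hf
  have hconv : ∀ x, ∫ y, heatKernel t (x - y) * f y = ∫ y, heatKernel t (x - y) * g y := by
    intro x
    refine integral_congr_ae ?_
    filter_upwards [hfg] with y hy
    rw [hy]
  simp_rw [hconv]
  rw [morreyNorm_congr_ae hfg]
  set β := ((3 - lam₁) / q₁ - (3 - lam₂) / q₂) / 2 with hβ
  have hmain : morreyNorm q₂ lam₂ (fun x => ∫ y, heatKernel t (x - y) * g y) ≤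
      ENNReal.ofReal (t ^ (-β)) * D ^ (1 / q₂) * morreyNorm q₁ lam₁ g := by
    refine morreyNorm_le_of_setLIntegral_le hq₂0 fun x r hr => ?_
    refine (setLIntegral_heat_conv_rpow_le hq₁ hq hlam hlam₂ ht hg.measurable x hr).trans_eq ?_
    rw [ENNReal.mul_rpow_of_nonneg _ _ hq₂0.le, ENNReal.mul_rpow_of_nonneg _ _ hq₂0.le,
      ← ENNReal.rpow_mul D, one_div_mul_cancel hq₂0.ne', ENNReal.rpow_one,
      ENNReal.ofReal_rpow_of_nonneg (by positivity) hq₂0.le, ← Real.rpow_mul ht.le]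
    congr 5
    rw [hβ]
    field_simp
    ring
  calc _ ≤ ENNReal.ofReal (t ^ β) *
        (ENNReal.ofReal (t ^ (-β)) * D ^ (1 / q₂) * morreyNorm q₁ lam₁ g) := by gcongr
    _ = D ^ (1 / q₂) * morreyNorm q₁ lam₁ g := by
        rw [← mul_assoc, ← mul_assoc, ← ENNReal.ofReal_mul (by positivity), ← Real.rpow_add ht]
        simp
    _ ≤ _ := by
        gcongr
        rw [← ENNReal.ofReal_toReal hD]
        exact ENNReal.ofReal_le_ofReal (by simp)
end
end

section
/- (Gradient of the heat semigroup between Morrey spaces.) Let 1 ≤ q₁ ≤ q₂ < ∞ and 0 ≤ λ₁ ≤ λ₂ < 3, and set α₁ = (3−λ₁)/q₁ and α₂ = (3−λ₂)/q₂. Then there exists a constant C > 0, depending only on q₁, q₂, λ₁, λ₂, such that for every t > 0 and every f ∈ M^{q₁,λ₁}(ℝ³), t^{1/2 + (α₁−α₂)/2} ‖∇G(·,t)∗f‖_{q₂,λ₂} ≤ C ‖f‖_{q₁,λ₁}, where ∇G(·,t) denotes the spatial gradient of the heat kernel at time t. -/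
open MeasureTheory Metric Real Set Filter
open scoped ENNReal NNReal BigOperators Topology

noncomputable section

/-- Superposition of indicators of concentric balls, dominating the rescaled heat gradient. -/
def ballMajorant (s : ℝ) (z : E3) : ℝ≥0∞ :=
  ∑' n : ℕ, (ball (0 : E3) ((n + 1) * s)).indicator
    (fun _ => ENNReal.ofReal (Real.exp (-n))) z

lemma measurable_ballMajorant (s : ℝ) : Measurable (ballMajorant s) :=
  Measurable.tsum fun _ => measurable_const.indicator measurableSet_ball

lemma hasGradientAt_heatKernel (t : ℝ) (z : E3) :
    HasGradientAt (heatKernel t) ((-(1 / (2 * t)) * heatKernel t z) • z) z := by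
  rw [hasGradientAt_iff_hasFDerivAt]
  have h := ((((hasStrictFDerivAt_norm_sq z).hasFDerivAt.neg).mul_const
    ((4 * t)⁻¹)).exp).const_mul ((4 * π * t) ^ (-(3 : ℝ) / 2))
  refine HasFDerivAt.congr_fderiv (h.congr_of_eventuallyEq ?_) ?_
  · exact Eventually.of_forall fun x => by simp [heatKernel, div_eq_mul_inv]
  · ext v
    simp [heatKernel, div_eq_mul_inv]
    ring

lemma gradient_heatKernel (t : ℝ) (z : E3) :
    gradient (heatKernel t) z = (-(1 / (2 * t)) * heatKernel t z) • z :=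
  (hasGradientAt_heatKernel t z).gradient

lemma exp_neg_le_ballMajorant {s : ℝ} (hs : 0 < s) (z : E3) :
    ENNReal.ofReal (Real.exp (-(‖z‖ / s))) ≤ ballMajorant s z := by
  refine le_trans ?_ (ENNReal.le_tsum ⌊‖z‖ / s⌋₊)
  have hz : z ∈ ball (0 : E3) ((⌊‖z‖ / s⌋₊ + 1) * s) := by
    rw [mem_ball_zero_iff, ← div_lt_iff₀ hs]
    exact Nat.lt_floor_add_one _
  rw [indicator_of_mem hz]
  refine ENNReal.ofReal_le_ofReal (Real.exp_le_exp.2 (neg_le_neg ?_))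
  exact Nat.floor_le (by positivity)

lemma norm_gradient_heatKernel_le {s : ℝ} (hs : 0 < s) (z : E3) :
    ‖gradient (heatKernel (s ^ 2)) z‖ ≤
      Real.exp (9 / 4) * s ^ (-4 : ℝ) * Real.exp (-(‖z‖ / s)) := by
  have hπ : (4 * π * s ^ 2) ^ (-(3 : ℝ) / 2) ≤ s ^ (-3 : ℝ) := by
    have : s ^ (-3 : ℝ) = (s ^ 2) ^ (-(3 : ℝ) / 2) := by
      rw [← Real.rpow_natCast, ← Real.rpow_mul hs.le]; norm_num
    rw [this]
    refine Real.rpow_le_rpow_of_nonpos (by positivity) ?_ (by norm_num)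
    nlinarith [Real.pi_gt_three, sq_pos_of_pos hs]
  have hexp : ‖z‖ / s / 2 * Real.exp (-‖z‖ ^ 2 / (4 * s ^ 2)) ≤
      Real.exp (9 / 4) * Real.exp (-(‖z‖ / s)) := by
    set w := ‖z‖ / s with hw
    have e : -‖z‖ ^ 2 / (4 * s ^ 2) = -w ^ 2 / 4 := by rw [hw]; field_simp
    rw [e, ← Real.exp_add]
    calc w / 2 * Real.exp (-w ^ 2 / 4) ≤ Real.exp (w / 2) * Real.exp (-w ^ 2 / 4) := by
          gcongr; linarith [Real.add_one_le_exp (w / 2)]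
      _ ≤ _ := by
          rw [← Real.exp_add]
          exact Real.exp_le_exp.2 (by nlinarith [sq_nonneg (w - 3)])
  have hs4 : s ^ (-4 : ℝ) = s ^ (-3 : ℝ) * s⁻¹ := by
    rw [← Real.rpow_neg_one s, ← Real.rpow_add hs]; norm_num
  rw [gradient_heatKernel, norm_smul, heatKernel, norm_mul, norm_neg,
    Real.norm_of_nonneg (by positivity), Real.norm_of_nonneg (by positivity), hs4]
  calc 1 / (2 * s ^ 2) * ((4 * π * s ^ 2) ^ (-(3 : ℝ) / 2) *
          Real.exp (-‖z‖ ^ 2 / (4 * s ^ 2))) * ‖z‖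
      = (4 * π * s ^ 2) ^ (-(3 : ℝ) / 2) * s⁻¹ *
          (‖z‖ / s / 2 * Real.exp (-‖z‖ ^ 2 / (4 * s ^ 2))) := by field_simp
    _ ≤ s ^ (-3 : ℝ) * s⁻¹ * (Real.exp (9 / 4) * Real.exp (-(‖z‖ / s))) := by gcongr
    _ = _ := by ring

lemma enorm_gradient_heatKernel_le {s : ℝ} (hs : 0 < s) (z : E3) :
    ‖gradient (heatKernel (s ^ 2)) z‖ₑ ≤
      ENNReal.ofReal (Real.exp (9 / 4)) * ENNReal.ofReal s ^ (-4 : ℝ) * ballMajorant s z := by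
  rw [← ofReal_norm, ENNReal.ofReal_rpow_of_pos hs]
  refine (ENNReal.ofReal_le_ofReal (norm_gradient_heatKernel_le hs z)).trans ?_
  rw [ENNReal.ofReal_mul (by positivity), ENNReal.ofReal_mul (by positivity)]
  gcongr
  exact exp_neg_le_ballMajorant hs z

lemma summable_exp_neg_mul_cube :
    Summable fun n : ℕ => Real.exp (-n) * ((n : ℝ) + 1) ^ 3 := by
  have h := ((summable_nat_add_iff 1).2 (Real.summable_pow_mul_exp_neg_nat_mul 3 one_pos)).mul_left
    (Real.exp 1)
  refine h.congr fun n => ?_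
  have : Real.exp (-n) = Real.exp 1 * Real.exp (-1 * ((n + 1 : ℕ) : ℝ)) := by
    rw [← Real.exp_add]; push_cast; ring_nf
  rw [this]; push_cast; ring

/-- A function of Morrey growth `D r ^ lam` on balls has a controlled integral against the
translates of `ballMajorant s`. -/
lemma lintegral_ballMajorant_mul_le {s lam : ℝ} (hs : 0 < s) (hlam : lam ≤ 3)
    {F : E3 → ℝ≥0∞} (hF : Measurable F) {D : ℝ≥0∞}
    (hD : ∀ x r, 0 < r → ∫⁻ y in ball x r, F y ≤ D * ENNReal.ofReal r ^ lam) (x : E3) :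
    ∫⁻ y, ballMajorant s (x - y) * F y ≤
      ENNReal.ofReal (∑' n : ℕ, Real.exp (-n) * ((n : ℝ) + 1) ^ 3) *
        (ENNReal.ofReal s ^ lam * D) := by
  simp_rw [ballMajorant, ← ENNReal.tsum_mul_right]
  have hmeas : ∀ n : ℕ, Measurable fun y => (ball (0 : E3) ((n + 1) * s)).indicator
      (fun _ => ENNReal.ofReal (Real.exp (-n))) (x - y) * F y := fun n =>
    ((measurable_const.indicator measurableSet_ball).comp
      (measurable_const.sub measurable_id)).mul hF
  rw [lintegral_tsum fun n => (hmeas n).aemeasurable,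
    ENNReal.ofReal_tsum_of_nonneg (fun n => by positivity) summable_exp_neg_mul_cube,
    ← ENNReal.tsum_mul_right]
  refine ENNReal.tsum_le_tsum fun n => ?_
  have h1 : ∀ y, (ball (0 : E3) ((n + 1) * s)).indicator
      (fun _ => ENNReal.ofReal (Real.exp (-n))) (x - y) * F y =
      (ball x ((n + 1) * s)).indicator (fun y => ENNReal.ofReal (Real.exp (-n)) * F y) y := by
    intro y
    have : x - y ∈ ball (0 : E3) ((n + 1) * s) ↔ y ∈ ball x ((n + 1) * s) := by
      rw [mem_ball_zero_iff, mem_ball', dist_eq_norm]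
    by_cases h : y ∈ ball x ((n + 1) * s)
    · rw [indicator_of_mem h, indicator_of_mem (this.2 h)]
    · rw [indicator_of_notMem h, indicator_of_notMem (mt this.1 h), zero_mul]
  simp_rw [h1]
  rw [lintegral_indicator measurableSet_ball, lintegral_const_mul _ hF,
    ENNReal.ofReal_mul (by positivity), mul_assoc]
  gcongr
  refine (hD x _ (by positivity)).trans ?_
  rw [ENNReal.ofReal_mul (by positivity), ENNReal.mul_rpow_of_ne_top (by simp) (by simp),
    mul_comm D, mul_assoc]
  gcongr
  rw [ENNReal.ofReal_rpow_of_pos (by positivity)]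
  refine ENNReal.ofReal_le_ofReal ?_
  rw [← Real.rpow_natCast]
  exact Real.rpow_le_rpow_of_exponent_le (by linarith [n.cast_nonneg (α := ℝ)]) (by simpa using hlam)

lemma rpow_lintegral_mul_le {α : Type*} [MeasurableSpace α] {μ : Measure α} {q : ℝ} (hq : 1 ≤ q)
    {K F : α → ℝ≥0∞} (hK : Measurable K) (hF : Measurable F) :
    (∫⁻ y, K y * F y ∂μ) ^ q ≤ (∫⁻ y, K y ∂μ) ^ (q - 1) * ∫⁻ y, K y * F y ^ q ∂μ := by
  have hq0 : 0 < q := by linarith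
  have h := ENNReal.lintegral_mul_norm_pow_le (μ := μ) hK.aemeasurable
    (hK.mul (hF.pow_const q)).aemeasurable (p := 1 - 1 / q) (q := 1 / q)
    (by rw [sub_nonneg, div_le_one hq0]; exact hq) (by positivity) (by ring)
  have e : ∀ y, K y ^ (1 - 1 / q) * (K y * F y ^ q) ^ (1 / q) = K y * F y := by
    intro y
    rw [ENNReal.mul_rpow_of_nonneg _ _ (by positivity), ← ENNReal.rpow_mul, mul_one_div_cancel hq0.ne',
      ENNReal.rpow_one, ← mul_assoc, ← ENNReal.rpow_add_of_nonneg _ _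
      (by rw [sub_nonneg, div_le_one hq0]; exact hq) (by positivity)]
    simp
  simp only [Pi.mul_apply, e] at h
  refine (ENNReal.rpow_le_rpow h hq0.le).trans_eq ?_
  rw [ENNReal.mul_rpow_of_nonneg _ _ hq0.le, ← ENNReal.rpow_mul, ← ENNReal.rpow_mul,
    one_div_mul_cancel hq0.ne', ENNReal.rpow_one, sub_mul, one_div_mul_cancel hq0.ne', one_mul]

lemma volume_ball_E3 (x : E3) {r : ℝ} (hr : 0 < r) :
    volume (ball x r) = volume (ball (0 : E3) 1) * ENNReal.ofReal r ^ (3 : ℝ) := by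
  rw [Measure.addHaar_ball _ _ hr.le, mul_comm, ENNReal.ofReal_pow hr.le, ← ENNReal.rpow_natCast]
  simp

lemma lintegral_rpow_ball_le {F : Type*} [NormedAddCommGroup F] {p lam : ℝ} (hp : 1 ≤ p)
    (f : E3 → F) (x : E3) {r : ℝ} (hr : 0 < r) :
    ∫⁻ y in ball x r, ‖f y‖ₑ ^ p ≤ morreyNorm p lam f ^ p * ENNReal.ofReal r ^ lam := by
  have hp0 : 0 < p := by linarith
  have h : ENNReal.ofReal (r ^ (-(lam / p))) * (∫⁻ y in ball x r, ‖f y‖ₑ ^ p) ^ (1 / p) ≤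
      morreyNorm p lam f :=
    le_iSup_of_le x (le_iSup_of_le r (le_iSup_of_le hr le_rfl))
  have h2 := ENNReal.rpow_le_rpow h hp0.le
  rw [ENNReal.mul_rpow_of_nonneg _ _ hp0.le, ← ENNReal.rpow_mul, one_div_mul_cancel hp0.ne',
    ENNReal.rpow_one, ← ENNReal.ofReal_rpow_of_pos hr, ← ENNReal.rpow_mul, neg_mul,
    div_mul_cancel₀ _ hp0.ne'] at h2
  have hr0 : ENNReal.ofReal r ≠ 0 := by simpa using hr
  calc _ = ENNReal.ofReal r ^ (-lam) * (∫⁻ y in ball x r, ‖f y‖ₑ ^ p) * ENNReal.ofReal r ^ lam := by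
        rw [mul_right_comm, ← ENNReal.rpow_add _ _ hr0 (by simp)]; simp
    _ ≤ _ := by gcongr

lemma aestronglyMeasurable_of_smul_gradient_heatKernel {t : ℝ} (ht : 0 < t) {f : E3 → ℝ} {x : E3}
    (h : AEStronglyMeasurable (fun y => f y • gradient (heatKernel t) (x - y)) volume) :
    AEStronglyMeasurable f volume := by
  have hk : Continuous (heatKernel t) := by unfold heatKernel; fun_prop
  have hpos : ∀ z, 0 < heatKernel t z := fun z => by unfold heatKernel; positivity
  have hm : AEStronglyMeasurable
      (fun y => (-(1 / (2 * t)) * heatKernel t (x - y) * ‖x - y‖ ^ 2)⁻¹) volume :=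
    (Measurable.inv (Continuous.measurable (by fun_prop))).aestronglyMeasurable
  refine ((h.inner (𝕜 := ℝ) (g := fun y => x - y)
    (Continuous.aestronglyMeasurable (by fun_prop))).mul hm).congr ?_
  filter_upwards [compl_mem_ae_iff.2 (measure_singleton (μ := volume) x)] with y hy
  have hy' : ‖x - y‖ ≠ 0 := norm_ne_zero_iff.2 (sub_ne_zero.2 (Ne.symm hy))
  have := (hpos (x - y)).ne'
  simp only [Pi.mul_apply, gradient_heatKernel, inner_smul_left, real_inner_self_eq_norm_sq]
  simp
  field_simp

/-- Volume of the unit ball, bounded below by one. -/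
def unitBallConst : ℝ≥0∞ := max 1 (volume (ball (0 : E3) 1))

/-- Constant bounding the mass and the Morrey growth of `ballMajorant`. -/
def majorantConst : ℝ≥0∞ :=
  ENNReal.ofReal (∑' n : ℕ, Real.exp (-n) * ((n : ℝ) + 1) ^ 3) * unitBallConst

lemma unitBallConst_ne_top : unitBallConst ≠ ⊤ := by
  simp [unitBallConst]

lemma one_le_unitBallConst : 1 ≤ unitBallConst := le_max_left _ _

lemma majorantConst_ne_top : majorantConst ≠ ⊤ :=
  ENNReal.mul_ne_top ENNReal.ofReal_ne_top unitBallConst_ne_top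

lemma volume_ball_le (x : E3) {r : ℝ} (hr : 0 < r) :
    volume (ball x r) ≤ unitBallConst * ENNReal.ofReal r ^ (3 : ℝ) := by
  rw [volume_ball_E3 x hr]
  gcongr
  exact le_max_right _ _

lemma lintegral_ballMajorant_sub_le {s : ℝ} (hs : 0 < s) (x : E3) :
    ∫⁻ y, ballMajorant s (x - y) ≤ majorantConst * ENNReal.ofReal s ^ (3 : ℝ) := by
  have h := lintegral_ballMajorant_mul_le hs le_rfl (F := fun _ => 1) measurable_const
    (D := unitBallConst) (fun x r hr => by simpa using volume_ball_le x hr) x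
  simp only [mul_one] at h
  refine h.trans_eq ?_
  rw [majorantConst]; ring

lemma measurable_ballMajorant_sub (s : ℝ) (x : E3) : Measurable fun y => ballMajorant s (x - y) :=
  (measurable_ballMajorant s).comp (measurable_const.sub measurable_id)

lemma rpow_lintegral_ballMajorant_le {s q : ℝ} (hs : 0 < s) (hq : 1 ≤ q) {F : E3 → ℝ≥0∞}
    (hF : Measurable F) (x : E3) :
    (∫⁻ y, ballMajorant s (x - y) * F y) ^ q ≤
      (majorantConst * ENNReal.ofReal s ^ (3 : ℝ)) ^ (q - 1) *
        ∫⁻ y, ballMajorant s (x - y) * F y ^ q := by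
  refine (rpow_lintegral_mul_le hq (measurable_ballMajorant_sub s x) hF).trans ?_
  gcongr
  exact lintegral_ballMajorant_sub_le hs x

lemma rpow_lintegral_ballMajorant_le_of_morrey {s q lam : ℝ} (hs : 0 < s) (hq : 1 ≤ q)
    (hlam : lam ≤ 3) {F : E3 → ℝ≥0∞} (hF : Measurable F) {N : ℝ≥0∞}
    (hN : ∀ x r, 0 < r → ∫⁻ y in ball x r, F y ^ q ≤ N ^ q * ENNReal.ofReal r ^ lam) (x : E3) :
    (∫⁻ y, ballMajorant s (x - y) * F y) ^ q ≤
      (majorantConst * ENNReal.ofReal s ^ (3 : ℝ)) ^ (q - 1) *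
        (majorantConst * (ENNReal.ofReal s ^ lam * N ^ q)) := by
  refine (rpow_lintegral_ballMajorant_le hs hq hF x).trans ?_
  gcongr
  refine (lintegral_ballMajorant_mul_le hs hlam (hF.pow_const q) hN x).trans ?_
  gcongr
  exact le_mul_of_one_le_right' one_le_unitBallConst

lemma setLIntegral_ball_sub (F : E3 → ℝ≥0∞) (x z : E3) (r : ℝ) :
    ∫⁻ y in ball x r, F (y - z) = ∫⁻ y in ball (x - z) r, F y := by
  rw [← lintegral_indicator measurableSet_ball, ← lintegral_indicator measurableSet_ball,
    ← lintegral_sub_right_eq_self ((ball (x - z) r).indicator F) z]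
  refine lintegral_congr fun y => ?_
  have : y - z ∈ ball (x - z) r ↔ y ∈ ball x r := by simp [mem_ball]
  by_cases h : y ∈ ball x r
  · rw [indicator_of_mem h, indicator_of_mem (this.2 h)]
  · rw [indicator_of_notMem h, indicator_of_notMem (mt this.1 h)]

lemma setLIntegral_rpow_lintegral_ballMajorant_le {s q lam : ℝ} (hs : 0 < s) (hq : 1 ≤ q)
    {F : E3 → ℝ≥0∞} (hF : Measurable F) {N : ℝ≥0∞}
    (hN : ∀ x r, 0 < r → ∫⁻ y in ball x r, F y ^ q ≤ N ^ q * ENNReal.ofReal r ^ lam)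
    (x : E3) {r : ℝ} (hr : 0 < r) :
    ∫⁻ w in ball x r, (∫⁻ y, ballMajorant s (w - y) * F y) ^ q ≤
      (majorantConst * ENNReal.ofReal s ^ (3 : ℝ)) ^ q * (N ^ q * ENNReal.ofReal r ^ lam) := by
  set P := majorantConst * ENNReal.ofReal s ^ (3 : ℝ)
  have hG : Measurable fun y => F y ^ q := hF.pow_const q
  have hM := measurable_ballMajorant s
  have hmass : ∫⁻ z, ballMajorant s z ≤ P := by
    rw [← lintegral_sub_left_eq_self _ (0 : E3)]
    exact lintegral_ballMajorant_sub_le hs 0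
  have hconv : ∀ w, ∫⁻ y, ballMajorant s (w - y) * F y ^ q =
      ∫⁻ z, ballMajorant s z * F (w - z) ^ q := fun w => by
    rw [← lintegral_sub_left_eq_self _ w]
    simp
  have hP : P ^ q = P ^ (q - 1) * P := by
    conv_lhs => rw [← sub_add_cancel q 1, ENNReal.rpow_add_of_nonneg _ _ (by linarith) zero_le_one,
      ENNReal.rpow_one]
  have hPtop : P ^ (q - 1) ≠ ⊤ := ENNReal.rpow_ne_top_of_nonneg (by linarith)
    (ENNReal.mul_ne_top majorantConst_ne_top
      (ENNReal.rpow_ne_top_of_nonneg (by norm_num) ENNReal.ofReal_ne_top))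
  calc ∫⁻ w in ball x r, (∫⁻ y, ballMajorant s (w - y) * F y) ^ q
      ≤ ∫⁻ w in ball x r, P ^ (q - 1) * ∫⁻ z, ballMajorant s z * F (w - z) ^ q := by
        refine lintegral_mono fun w => ?_
        rw [← hconv w]
        exact rpow_lintegral_ballMajorant_le hs hq hF w
    _ = P ^ (q - 1) * ∫⁻ z, ∫⁻ w in ball x r, ballMajorant s z * F (w - z) ^ q := by
        rw [lintegral_const_mul' _ _ hPtop, lintegral_lintegral_swap]
        exact ((hM.comp measurable_snd).mul
          (hG.comp (measurable_fst.sub measurable_snd))).aemeasurable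
    _ ≤ P ^ (q - 1) * ∫⁻ z, ballMajorant s z * (N ^ q * ENNReal.ofReal r ^ lam) := by
        gcongr with z
        rw [lintegral_const_mul _ (by fun_prop), setLIntegral_ball_sub (fun y => F y ^ q)]
        gcongr
        exact hN _ r hr
    _ ≤ P ^ q * (N ^ q * ENNReal.ofReal r ^ lam) := by
        rw [lintegral_mul_const _ hM, hP, mul_assoc]
        gcongr

/-- Interpolation between a sup bound and an `L^{q₁}` Morrey bound at the length scale `s`. -/
lemma morrey_interpolation {q₁ q₂ lam₁ lam₂ : ℝ} (hq₁ : 1 ≤ q₁) (hq : q₁ ≤ q₂)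
    (hlam : lam₁ ≤ lam₂) (hlam₂ : lam₂ < 3) {s : ℝ} (hs : 0 < s) {U : E3 → ℝ≥0∞} {B : ℝ≥0∞}
    (hsup : ∀ x, U x ≤ B * ENNReal.ofReal s ^ (-1 - (3 - lam₁) / q₁))
    {x : E3} {r : ℝ} (hr : 0 < r)
    (hint : ∫⁻ y in ball x r, U y ^ q₁ ≤
      (B * ENNReal.ofReal s ^ (-1 : ℝ)) ^ q₁ * ENNReal.ofReal r ^ lam₁) :
    ENNReal.ofReal r ^ (-(lam₂ / q₂)) * (∫⁻ y in ball x r, U y ^ q₂) ^ (1 / q₂) ≤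
      unitBallConst * B *
        ENNReal.ofReal s ^ (-(1 + ((3 - lam₁) / q₁ - (3 - lam₂) / q₂))) := by
  have h1 : 0 < q₁ := by linarith
  have h2 : 0 < q₂ := by linarith
  have hσ0 : ENNReal.ofReal s ≠ 0 := by simpa using hs
  have hρ0 : ENNReal.ofReal r ≠ 0 := by simpa using hr
  have hσt : ENNReal.ofReal s ≠ ⊤ := ENNReal.ofReal_ne_top
  have hρt : ENNReal.ofReal r ≠ ⊤ := ENNReal.ofReal_ne_top
  set α := (3 - lam₁) / q₁ with hα
  rcases le_total s r with hsr | hrs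
  · have hle : ENNReal.ofReal r ^ (-((lam₂ - lam₁) / q₂)) ≤
        ENNReal.ofReal s ^ (-((lam₂ - lam₁) / q₂)) := by
      rw [ENNReal.rpow_neg, ENNReal.rpow_neg, ENNReal.inv_le_inv]
      exact ENNReal.rpow_le_rpow (ENNReal.ofReal_le_ofReal hsr)
        (div_nonneg (by linarith) h2.le)
    have hI : ∫⁻ y in ball x r, U y ^ q₂ ≤
        B ^ q₂ * ENNReal.ofReal s ^ ((-1 - α) * (q₂ - q₁) + -1 * q₁) *
          ENNReal.ofReal r ^ lam₁ := by
      have hpt : ∀ y, U y ^ q₂ ≤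
          (B * ENNReal.ofReal s ^ (-1 - α)) ^ (q₂ - q₁) * U y ^ q₁ := fun y => by
        conv_lhs => rw [← sub_add_cancel q₂ q₁,
          ENNReal.rpow_add_of_nonneg _ _ (by linarith) h1.le]
        gcongr
        exact hsup y
      by_cases hB : B = ⊤
      · have : B ^ q₂ * ENNReal.ofReal s ^ ((-1 - α) * (q₂ - q₁) + -1 * q₁) *
            ENNReal.ofReal r ^ lam₁ = ⊤ := by
          rw [hB, ENNReal.top_rpow_of_pos h2, ENNReal.top_mul, ENNReal.top_mul]
          · exact (ENNReal.rpow_pos (pos_iff_ne_zero.2 hρ0) hρt).ne'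
          · exact (ENNReal.rpow_pos (pos_iff_ne_zero.2 hσ0) hσt).ne'
        rw [this]; exact le_top
      calc ∫⁻ y in ball x r, U y ^ q₂
          ≤ ∫⁻ y in ball x r, (B * ENNReal.ofReal s ^ (-1 - α)) ^ (q₂ - q₁) * U y ^ q₁ :=
            lintegral_mono hpt
        _ = (B * ENNReal.ofReal s ^ (-1 - α)) ^ (q₂ - q₁) * ∫⁻ y in ball x r, U y ^ q₁ :=
            lintegral_const_mul' _ _ (ENNReal.rpow_ne_top_of_nonneg (by linarith)
              (ENNReal.mul_ne_top hB (ENNReal.rpow_ne_top_of_ne_zero hσ0 hσt)))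
        _ ≤ (B * ENNReal.ofReal s ^ (-1 - α)) ^ (q₂ - q₁) *
              ((B * ENNReal.ofReal s ^ (-1 : ℝ)) ^ q₁ * ENNReal.ofReal r ^ lam₁) := by gcongr
        _ = _ := by
            rw [ENNReal.mul_rpow_of_nonneg _ _ (by linarith),
              ENNReal.mul_rpow_of_nonneg _ _ h1.le, ← ENNReal.rpow_mul, ← ENNReal.rpow_mul,
              ENNReal.rpow_add _ _ hσ0 hσt]
            have hBq : B ^ q₂ = B ^ (q₂ - q₁) * B ^ q₁ := by
              rw [← ENNReal.rpow_add_of_nonneg _ _ (by linarith) h1.le, sub_add_cancel]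
            rw [hBq]; ring
    calc _ ≤ ENNReal.ofReal r ^ (-(lam₂ / q₂)) *
          (B ^ q₂ * ENNReal.ofReal s ^ ((-1 - α) * (q₂ - q₁) + -1 * q₁) *
            ENNReal.ofReal r ^ lam₁) ^ (1 / q₂) := by gcongr
      _ = B * ENNReal.ofReal s ^ (((-1 - α) * (q₂ - q₁) + -1 * q₁) * (1 / q₂)) *
            ENNReal.ofReal r ^ (-((lam₂ - lam₁) / q₂)) := by
          rw [ENNReal.mul_rpow_of_nonneg _ _ (by positivity),
            ENNReal.mul_rpow_of_nonneg _ _ (by positivity), ← ENNReal.rpow_mul,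
            ← ENNReal.rpow_mul, ← ENNReal.rpow_mul, mul_one_div_cancel h2.ne', ENNReal.rpow_one,
            show -((lam₂ - lam₁) / q₂) = -(lam₂ / q₂) + lam₁ * (1 / q₂) by ring,
            ENNReal.rpow_add _ _ hρ0 hρt]
          ring
      _ ≤ B * ENNReal.ofReal s ^ (((-1 - α) * (q₂ - q₁) + -1 * q₁) * (1 / q₂)) *
            ENNReal.ofReal s ^ (-((lam₂ - lam₁) / q₂)) := by gcongr
      _ = 1 * B * ENNReal.ofReal s ^ (-(1 + (α - (3 - lam₂) / q₂))) := by
          rw [mul_assoc, ← ENNReal.rpow_add _ _ hσ0 hσt, one_mul]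
          congr 2
          rw [hα]; field_simp; ring
      _ ≤ _ := by gcongr; exact one_le_unitBallConst
  · have hle : ENNReal.ofReal r ^ ((3 - lam₂) / q₂) ≤ ENNReal.ofReal s ^ ((3 - lam₂) / q₂) :=
      ENNReal.rpow_le_rpow (ENNReal.ofReal_le_ofReal hrs) (div_nonneg (by linarith) h2.le)
    have hV : unitBallConst ^ (1 / q₂) ≤ unitBallConst := by
      conv_rhs => rw [← ENNReal.rpow_one unitBallConst]
      exact ENNReal.rpow_le_rpow_of_exponent_le one_le_unitBallConst
        ((div_le_one h2).2 (by linarith))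
    have hI : ∫⁻ y in ball x r, U y ^ q₂ ≤ (B * ENNReal.ofReal s ^ (-1 - α)) ^ q₂ *
        (unitBallConst * ENNReal.ofReal r ^ (3 : ℝ)) := by
      calc _ ≤ ∫⁻ _ in ball x r, (B * ENNReal.ofReal s ^ (-1 - α)) ^ q₂ := by
            gcongr with y; exact hsup y
        _ = (B * ENNReal.ofReal s ^ (-1 - α)) ^ q₂ * volume (ball x r) := setLIntegral_const _ _
        _ ≤ _ := by gcongr; exact volume_ball_le x hr
    calc _ ≤ ENNReal.ofReal r ^ (-(lam₂ / q₂)) * ((B * ENNReal.ofReal s ^ (-1 - α)) ^ q₂ *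
        (unitBallConst * ENNReal.ofReal r ^ (3 : ℝ))) ^ (1 / q₂) := by gcongr
      _ = unitBallConst ^ (1 / q₂) * B * ENNReal.ofReal s ^ (-1 - α) *
            ENNReal.ofReal r ^ ((3 - lam₂) / q₂) := by
          rw [ENNReal.mul_rpow_of_nonneg _ _ (by positivity), ← ENNReal.rpow_mul,
            mul_one_div_cancel h2.ne', ENNReal.rpow_one,
            ENNReal.mul_rpow_of_nonneg _ _ (by positivity), ← ENNReal.rpow_mul,
            show (3 - lam₂) / q₂ = -(lam₂ / q₂) + 3 * (1 / q₂) by ring,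
            ENNReal.rpow_add _ _ hρ0 hρt]
          ring
      _ ≤ unitBallConst * B * ENNReal.ofReal s ^ (-1 - α) *
            ENNReal.ofReal s ^ ((3 - lam₂) / q₂) := by gcongr
      _ = _ := by
          rw [mul_assoc, ← ENNReal.rpow_add _ _ hσ0 hσt]
          congr 2
          ring

lemma enorm_integral_smul_gradient_heatKernel_le {s : ℝ} (hs : 0 < s) {f : E3 → ℝ} (x : E3) :
    ‖∫ y, f y • gradient (heatKernel (s ^ 2)) (x - y)‖ₑ ≤
      ENNReal.ofReal (Real.exp (9 / 4)) * ENNReal.ofReal s ^ (-4 : ℝ) *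
        ∫⁻ y, ballMajorant s (x - y) * ‖f y‖ₑ := by
  have hσ0 : ENNReal.ofReal s ≠ 0 := by simpa using hs
  refine (enorm_integral_le_lintegral_enorm _).trans ?_
  rw [← lintegral_const_mul' _ _ (ENNReal.mul_ne_top ENNReal.ofReal_ne_top
    (ENNReal.rpow_ne_top_of_ne_zero hσ0 ENNReal.ofReal_ne_top))]
  refine lintegral_mono fun y => ?_
  rw [enorm_smul, mul_comm, ← mul_assoc]
  gcongr
  exact enorm_gradient_heatKernel_le hs _

lemma morreyNorm_grad_heat_conv_le {q₁ q₂ lam₁ lam₂ : ℝ} (hq₁ : 1 ≤ q₁) (hq : q₁ ≤ q₂)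
    (hlam : lam₁ ≤ lam₂) (hlam₂ : lam₂ < 3) {s : ℝ} (hs : 0 < s) {f : E3 → ℝ}
    (hf : Measurable f) :
    morreyNorm q₂ lam₂ (fun x => ∫ y, f y • gradient (heatKernel (s ^ 2)) (x - y)) ≤
      unitBallConst * (ENNReal.ofReal (Real.exp (9 / 4)) * majorantConst * morreyNorm q₁ lam₁ f) *
        ENNReal.ofReal s ^ (-(1 + ((3 - lam₁) / q₁ - (3 - lam₂) / q₂))) := by
  have h1 : 0 < q₁ := by linarith
  have hσ0 : ENNReal.ofReal s ≠ 0 := by simpa using hs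
  have hσt : ENNReal.ofReal s ≠ ⊤ := ENNReal.ofReal_ne_top
  set σ := ENNReal.ofReal s
  set A := ENNReal.ofReal (Real.exp (9 / 4))
  set N := morreyNorm q₁ lam₁ f
  have hF : Measurable fun y => ‖f y‖ₑ := hf.enorm
  have hN : ∀ x r, 0 < r → ∫⁻ y in ball x r, ‖f y‖ₑ ^ q₁ ≤ N ^ q₁ * ENNReal.ofReal r ^ lam₁ :=
    fun x r hr => lintegral_rpow_ball_le hq₁ f x hr
  have hU := fun x => enorm_integral_smul_gradient_heatKernel_le hs (f := f) x
  refine iSup_le fun x => iSup_le fun r => iSup_le fun hr => ?_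
  rw [← ENNReal.ofReal_rpow_of_pos hr]
  refine morrey_interpolation hq₁ hq hlam hlam₂ hs (fun x => ?_) hr ?_
  · refine (hU x).trans ?_
    have hW := ENNReal.rpow_le_rpow (rpow_lintegral_ballMajorant_le_of_morrey hs hq₁
      (by linarith) hF hN x) (z := 1 / q₁) (by positivity)
    rw [← ENNReal.rpow_mul, mul_one_div_cancel h1.ne', ENNReal.rpow_one] at hW
    refine (mul_le_mul_right hW _).trans_eq ?_
    have e : (majorantConst * σ ^ (3 : ℝ)) ^ (q₁ - 1) * (majorantConst * (σ ^ lam₁ * N ^ q₁)) =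
        majorantConst ^ q₁ * (σ ^ (3 * (q₁ - 1) + lam₁) * N ^ q₁) := by
      have hPq : majorantConst ^ q₁ = majorantConst ^ (q₁ - 1) * majorantConst := by
        conv_lhs => rw [← sub_add_cancel q₁ 1,
          ENNReal.rpow_add_of_nonneg _ _ (by linarith) zero_le_one, ENNReal.rpow_one]
      rw [hPq, ENNReal.mul_rpow_of_nonneg _ _ (by linarith), ← ENNReal.rpow_mul,
        ENNReal.rpow_add _ _ hσ0 hσt]
      ring
    rw [e, ENNReal.mul_rpow_of_nonneg _ _ (by positivity),
      ENNReal.mul_rpow_of_nonneg _ _ (by positivity), ← ENNReal.rpow_mul, ← ENNReal.rpow_mul,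
      ← ENNReal.rpow_mul, mul_one_div_cancel h1.ne', ENNReal.rpow_one, ENNReal.rpow_one,
      show -1 - (3 - lam₁) / q₁ = -4 + (3 * (q₁ - 1) + lam₁) * (1 / q₁) by field_simp; ring,
      ENNReal.rpow_add _ _ hσ0 hσt]
    ring
  · have hW := setLIntegral_rpow_lintegral_ballMajorant_le hs hq₁ hF hN x hr
    calc _ ≤ ∫⁻ w in ball x r,
          (A * σ ^ (-4 : ℝ)) ^ q₁ * (∫⁻ y, ballMajorant s (w - y) * ‖f y‖ₑ) ^ q₁ := by
          refine lintegral_mono fun w => ?_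
          rw [← ENNReal.mul_rpow_of_nonneg _ _ h1.le]
          exact ENNReal.rpow_le_rpow (hU w) h1.le
      _ = (A * σ ^ (-4 : ℝ)) ^ q₁ *
          ∫⁻ w in ball x r, (∫⁻ y, ballMajorant s (w - y) * ‖f y‖ₑ) ^ q₁ :=
          lintegral_const_mul' _ _ (ENNReal.rpow_ne_top_of_nonneg h1.le
            (ENNReal.mul_ne_top ENNReal.ofReal_ne_top (ENNReal.rpow_ne_top_of_ne_zero hσ0 hσt)))
      _ ≤ (A * σ ^ (-4 : ℝ)) ^ q₁ *
          ((majorantConst * σ ^ (3 : ℝ)) ^ q₁ * (N ^ q₁ * ENNReal.ofReal r ^ lam₁)) := by gcongr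
      _ = _ := by
          rw [← mul_assoc, ← mul_assoc, ← ENNReal.mul_rpow_of_nonneg _ _ h1.le,
            ← ENNReal.mul_rpow_of_nonneg _ _ h1.le,
            show (-1 : ℝ) = -4 + 3 by norm_num, ENNReal.rpow_add _ _ hσ0 hσt]
          congr 2
          ring

/-- **Gradient of the heat semigroup between Morrey spaces.**  For
`1 ≤ q₁ ≤ q₂ < ∞`, `0 ≤ λ₁ ≤ λ₂ < 3`, `αᵢ = (3-λᵢ)/qᵢ`, one has
`t^{1/2 + (α₁-α₂)/2} ‖∇G(·,t) ∗ f‖_{q₂,λ₂} ≤ C ‖f‖_{q₁,λ₁}` for all `t > 0`. -/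
theorem grad_heat_conv_morrey (q₁ q₂ lam₁ lam₂ : ℝ)
    (hq₁ : 1 ≤ q₁) (hq : q₁ ≤ q₂) (hlam₁ : 0 ≤ lam₁) (hlam : lam₁ ≤ lam₂)
    (hlam₂ : lam₂ < 3) :
    ∃ C : ℝ, 0 < C ∧ ∀ t : ℝ, 0 < t → ∀ f : E3 → ℝ,
      ENNReal.ofReal (t ^ (1 / 2 + ((3 - lam₁) / q₁ - (3 - lam₂) / q₂) / 2)) *
          morreyNorm q₂ lam₂ (fun x => ∫ y, f y • gradient (heatKernel t) (x - y)) ≤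
        ENNReal.ofReal C * morreyNorm q₁ lam₁ f := by
  set Γ : ℝ≥0∞ := unitBallConst * (ENNReal.ofReal (Real.exp (9 / 4)) * majorantConst)
  have hΓ : Γ ≠ ⊤ := ENNReal.mul_ne_top unitBallConst_ne_top
    (ENNReal.mul_ne_top ENNReal.ofReal_ne_top majorantConst_ne_top)
  refine ⟨Γ.toReal + 1, by positivity, fun t ht f => ?_⟩
  have hΓC : Γ ≤ ENNReal.ofReal (Γ.toReal + 1) := by
    rw [← ENNReal.ofReal_toReal hΓ]
    exact ENNReal.ofReal_le_ofReal (by simp)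
  by_cases hf : AEStronglyMeasurable f volume
  · have hfg := hf.ae_eq_mk
    set g := hf.mk f
    have hg : Measurable g := hf.stronglyMeasurable_mk.measurable
    have hnorm : morreyNorm q₁ lam₁ f = morreyNorm q₁ lam₁ g := by
      unfold morreyNorm
      refine iSup_congr fun x => iSup_congr fun r => iSup_congr fun _ => ?_
      congr 2
      exact lintegral_congr_ae (ae_restrict_of_ae (hfg.mono fun y hy => by simp only [hy]))
    have hconv : (fun x => ∫ y, f y • gradient (heatKernel t) (x - y)) =
        fun x => ∫ y, g y • gradient (heatKernel t) (x - y) := funext fun x =>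
      integral_congr_ae (hfg.mono fun y hy => by simp only [hy])
    have hs : 0 < √t := Real.sqrt_pos.2 ht
    have hσ0 : ENNReal.ofReal √t ≠ 0 := by simpa using hs
    have h := morreyNorm_grad_heat_conv_le hq₁ hq hlam hlam₂ hs hg
    rw [Real.sq_sqrt ht.le] at h
    have htpow : t ^ (1 / 2 + ((3 - lam₁) / q₁ - (3 - lam₂) / q₂) / 2) =
        √t ^ (1 + ((3 - lam₁) / q₁ - (3 - lam₂) / q₂)) := by
      rw [Real.sqrt_eq_rpow, ← Real.rpow_mul ht.le]
      congr 1
      ring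
    rw [hnorm, hconv, htpow, ← ENNReal.ofReal_rpow_of_pos hs]
    refine (mul_le_mul_right h _).trans ?_
    rw [mul_left_comm, ← ENNReal.rpow_add _ _ hσ0 ENNReal.ofReal_ne_top, add_neg_cancel,
      ENNReal.rpow_zero, mul_one, ← mul_assoc]
    gcongr
  · have hzero : (fun x => ∫ y, f y • gradient (heatKernel t) (x - y)) = fun _ => 0 :=
      funext fun x => integral_non_aestronglyMeasurable
        (mt (aestronglyMeasurable_of_smul_gradient_heatKernel ht) hf)
    have h2 : 0 < q₂ := by linarith
    rw [hzero]
    simp [morreyNorm, h2]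
end
end
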